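/- For all K, μ, ν ∈ ℕ with K ≥ 1 and ν ≥ 2 there is a constant c = c(K, μ, ν) > 0 with the following property. Let φ : ℝ → ℝ be a smooth function periodic with period L > 0, let i₁, …, i_ν be nonnegative integers with i₁ + ⋯ + i_ν = μ and i_j ≤ K − 1 for each j, and set η = (μ + ν/2 − 1)/K. Then ∫₀^L |φ^{(i₁)}(x) · φ^{(i₂)}(x) ⋯ φ^{(i_ν)}(x)| dx ≤ c · L^{1−μ−ν} · (L·∫₀^L φ(x)² dx)^{(ν−η)/2} · ‖φ‖_{K,2}^{η}. -/

import Mathlib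

open MeasureTheory intervalIntegral

/-- The scale-invariant Sobolev-type norm
`‖φ‖_{K,2} = Σ_{j=0}^{K} L^{j+1/2} (∫₀^L (φ^{(j)})²)^{1/2}`. -/
noncomputable def sobNorm (K : ℕ) (L : ℝ) (φ : ℝ → ℝ) : ℝ :=
  ∑ j ∈ Finset.range (K + 1),
    L ^ ((j : ℝ) + 1 / 2) * (∫ x in (0:ℝ)..L, (iteratedDeriv j φ x) ^ 2) ^ ((1 : ℝ) / 2)

/-! ### Log-convex sequences -/

/-- A nonnegative log-convex sequence satisfies `a n ^ (n + 1) ≤ a 0 * a (n + 1) ^ n`. -/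
lemma pow_succ_le_of_logConvex {a : ℕ → ℝ} (ha : ∀ n, 0 ≤ a n)
    (h : ∀ n, a (n + 1) ^ 2 ≤ a n * a (n + 2)) (n : ℕ) :
    a n ^ (n + 1) ≤ a 0 * a (n + 1) ^ n := by
  induction n with
  | zero => simp
  | succ n ih =>
    rcases (ha (n + 1)).eq_or_lt with h0 | h0
    · rw [← h0, zero_pow (by omega)]
      exact mul_nonneg (ha 0) (pow_nonneg (ha _) _)
    · refine le_of_mul_le_mul_left ?_ (pow_pos h0 n)
      calc a (n + 1) ^ n * a (n + 1) ^ (n + 1 + 1)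
          = (a (n + 1) ^ 2) ^ (n + 1) := by ring
        _ ≤ (a n * a (n + 2)) ^ (n + 1) := pow_le_pow_left₀ (sq_nonneg _) (h n) _
        _ = a n ^ (n + 1) * a (n + 2) ^ (n + 1) := mul_pow _ _ _
        _ ≤ a 0 * a (n + 1) ^ n * a (n + 2) ^ (n + 1) :=
            mul_le_mul_of_nonneg_right ih (pow_nonneg (ha _) _)
        _ = a (n + 1) ^ n * (a 0 * a (n + 1 + 1) ^ (n + 1)) := by ring

/-- Interpolation between the endpoints `0` and `j + m` of a nonnegative log-convex sequence. -/
lemma pow_add_le_of_logConvex {a : ℕ → ℝ} (ha : ∀ n, 0 ≤ a n)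
    (h : ∀ n, a (n + 1) ^ 2 ≤ a n * a (n + 2)) (j m : ℕ) :
    a j ^ (j + m) ≤ a 0 ^ m * a (j + m) ^ j := by
  induction m with
  | zero => simp
  | succ m ih =>
    rcases Nat.eq_zero_or_pos (j + m) with h0 | h0
    · obtain ⟨rfl, rfl⟩ : j = 0 ∧ m = 0 := by omega
      simp
    · refine le_of_pow_le_pow_left₀ h0.ne'
        (mul_nonneg (pow_nonneg (ha _) _) (pow_nonneg (ha _) _)) ?_
      calc (a j ^ (j + (m + 1))) ^ (j + m)
          = (a j ^ (j + m)) ^ (j + m + 1) := by rw [← pow_mul, ← pow_mul, mul_comm]; rfl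
        _ ≤ (a 0 ^ m * a (j + m) ^ j) ^ (j + m + 1) :=
            pow_le_pow_left₀ (pow_nonneg (ha _) _) ih _
        _ = a 0 ^ (m * (j + m + 1)) * (a (j + m) ^ (j + m + 1)) ^ j := by ring
        _ ≤ a 0 ^ (m * (j + m + 1)) * (a 0 * a (j + m + 1) ^ (j + m)) ^ j :=
            mul_le_mul_of_nonneg_left (pow_le_pow_left₀ (pow_nonneg (ha _) _)
              (pow_succ_le_of_logConvex ha h _) _) (pow_nonneg (ha _) _)
        _ = (a 0 ^ (m + 1) * a (j + (m + 1)) ^ j) ^ (j + m) := by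
            rw [← add_assoc j m 1]; ring

lemma le_rpow_mul_rpow_of_logConvex {a : ℕ → ℝ} (ha : ∀ n, 0 ≤ a n)
    (h : ∀ n, a (n + 1) ^ 2 ≤ a n * a (n + 2)) {j K : ℕ} (hK : 1 ≤ K) (hj : j ≤ K) :
    a j ≤ a 0 ^ (1 - (j : ℝ) / K) * a K ^ ((j : ℝ) / K) := by
  obtain ⟨m, rfl⟩ := Nat.exists_eq_add_of_le hj
  have hK0 : ((j + m : ℕ) : ℝ) ≠ 0 := by positivity
  refine le_of_pow_le_pow_left₀ (n := j + m) (by omega)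
    (mul_nonneg (Real.rpow_nonneg (ha _) _) (Real.rpow_nonneg (ha _) _)) ?_
  rw [mul_pow, ← Real.rpow_mul_natCast (ha _), ← Real.rpow_mul_natCast (ha _),
    div_mul_cancel₀ _ hK0, sub_mul, div_mul_cancel₀ _ hK0, one_mul, Nat.cast_add,
    add_sub_cancel_left, Real.rpow_natCast, Real.rpow_natCast]
  exact pow_add_le_of_logConvex ha h j m

/-! ### Integral inequalities on an interval -/

/-- Cauchy–Schwarz for continuous functions on an interval. -/
lemma integral_abs_mul_le_sqrt_mul_sqrt {f g : ℝ → ℝ} {a b : ℝ} (hf : Continuous f)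
    (hg : Continuous g) (hab : a ≤ b) :
    ∫ x in a..b, |f x * g x| ≤
      √(∫ x in a..b, f x ^ 2) * √(∫ x in a..b, g x ^ 2) := by
  have hquad : ∀ t : ℝ, 0 ≤ (∫ x in a..b, f x ^ 2) * (t * t) +
      (-2 * ∫ x in a..b, |f x * g x|) * t + ∫ x in a..b, g x ^ 2 := by
    intro t
    have hnonneg : 0 ≤ ∫ x in a..b, (t * |f x| - |g x|) ^ 2 :=
      integral_nonneg hab fun x _ => sq_nonneg _
    have hexp : ∀ x, (t * |f x| - |g x|) ^ 2 =
        (t * t) * f x ^ 2 + (-2 * t) * |f x * g x| + g x ^ 2 := by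
      intro x
      rw [abs_mul, ← sq_abs (f x), ← sq_abs (g x)]
      ring
    simp_rw [hexp] at hnonneg
    rw [integral_add (Continuous.intervalIntegrable (by fun_prop) _ _)
        (Continuous.intervalIntegrable (by fun_prop) _ _),
      integral_add (Continuous.intervalIntegrable (by fun_prop) _ _)
        (Continuous.intervalIntegrable (by fun_prop) _ _),
      intervalIntegral.integral_const_mul, intervalIntegral.integral_const_mul] at hnonneg
    linarith
  have hdisc := discrim_le_zero hquad
  rw [discrim] at hdisc
  rw [← Real.sqrt_mul (integral_nonneg hab fun x _ => sq_nonneg _)]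
  exact Real.le_sqrt_of_sq_le (by linarith)

/-- The sup norm of a `C¹` function on `[0, L]` is controlled by the `L²` norms of the function
and of its derivative. -/
lemma mul_sq_le_integral_sq_add {f f' : ℝ → ℝ} {L : ℝ} (hL : 0 < L)
    (hf : ∀ x, HasDerivAt f (f' x) x) (hf' : Continuous f') {x : ℝ} (hx : x ∈ Set.Icc 0 L) :
    L * f x ^ 2 ≤ (∫ y in (0:ℝ)..L, f y ^ 2) +
      2 * L * (√(∫ y in (0:ℝ)..L, f y ^ 2) * √(∫ y in (0:ℝ)..L, f' y ^ 2)) := by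
  have hc : Continuous f := continuous_iff_continuousAt.2 fun x => (hf x).continuousAt
  set M := √(∫ y in (0:ℝ)..L, f y ^ 2) * √(∫ y in (0:ℝ)..L, f' y ^ 2)
  have hM : ∫ y in (0:ℝ)..L, |f y * f' y| ≤ M := integral_abs_mul_le_sqrt_mul_sqrt hc hf' hL.le
  have hosc : ∀ y ∈ Set.Icc (0:ℝ) L, f x ^ 2 - 2 * M ≤ f y ^ 2 := by
    intro y hy
    have hftc : ∫ z in y..x, 2 * (f z * f' z) = f x ^ 2 - f y ^ 2 := by
      refine integral_eq_sub_of_hasDerivAt (f := fun z => f z ^ 2) (fun z _ => ?_)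
        (Continuous.intervalIntegrable (by fun_prop) _ _)
      simpa [mul_assoc] using (hf z).fun_pow 2
    have habs : |∫ z in y..x, f z * f' z| ≤ ∫ z in (0:ℝ)..L, |f z * f' z| := by
      have := norm_integral_le_abs_integral_norm (f := fun z => f z * f' z) (μ := volume)
        (a := y) (b := x)
      simp only [Real.norm_eq_abs] at this
      refine this.trans ?_
      have hint : IntervalIntegrable (fun z => |f z * f' z|) volume 0 L :=
        Continuous.intervalIntegrable (by fun_prop) _ _
      have hmono := abs_integral_mono_interval (μ := volume) (c := 0) (d := L) (a := y) (b := x)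
        (Set.uIoc_subset_uIoc_of_uIcc_subset_uIcc
          (Set.uIcc_subset_uIcc (Set.Icc_subset_uIcc hy) (Set.Icc_subset_uIcc hx)))
        (Filter.Eventually.of_forall fun z => abs_nonneg (f z * f' z)) hint
      rwa [abs_of_nonneg (a := ∫ z in (0:ℝ)..L, |f z * f' z|)
        (integral_nonneg hL.le fun z _ => abs_nonneg _)] at hmono
    rw [intervalIntegral.integral_const_mul] at hftc
    linarith [le_abs_self (∫ z in y..x, f z * f' z)]
  have hint := integral_mono_on (μ := volume) hL.le
    (Continuous.intervalIntegrable (by fun_prop) _ _)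
    (Continuous.intervalIntegrable (by fun_prop) _ _) hosc
  rw [intervalIntegral.integral_const, smul_eq_mul] at hint
  linarith

/-- Integration by parts for periodic boundary values, followed by Cauchy–Schwarz. -/
lemma integral_deriv_sq_le_sqrt_mul_sqrt {f f' f'' : ℝ → ℝ} {a b : ℝ} (hab : a ≤ b)
    (hf : ∀ x, HasDerivAt f (f' x) x) (hf' : ∀ x, HasDerivAt f' (f'' x) x)
    (hf'' : Continuous f'') (hfab : f a = f b) (hfab' : f' a = f' b) :
    ∫ x in a..b, f' x ^ 2 ≤ √(∫ x in a..b, f x ^ 2) * √(∫ x in a..b, f'' x ^ 2) := by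
  have hc : Continuous f := continuous_iff_continuousAt.2 fun x => (hf x).continuousAt
  have hc' : Continuous f' := continuous_iff_continuousAt.2 fun x => (hf' x).continuousAt
  have hparts := integral_mul_deriv_eq_deriv_mul (a := a) (b := b) (fun x _ => hf' x)
    (fun x _ => hf x) (hf''.intervalIntegrable _ _) (hc'.intervalIntegrable _ _)
  rw [hfab, hfab', sub_self, zero_sub] at hparts
  calc ∫ x in a..b, f' x ^ 2 = -∫ x in a..b, f'' x * f x := by simp_rw [sq, hparts]
    _ ≤ |∫ x in a..b, f'' x * f x| := neg_le_abs _
    _ ≤ ∫ x in a..b, |f'' x * f x| := abs_integral_le_integral_abs hab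
    _ ≤ _ := (integral_abs_mul_le_sqrt_mul_sqrt hf'' hc hab).trans_eq (mul_comm _ _)

/-! ### Scale-invariant norms of derivatives -/

lemma ContDiff.hasDerivAt_iteratedDeriv {φ : ℝ → ℝ} (hφ : ContDiff ℝ (⊤ : ℕ∞) φ) (j : ℕ) (x : ℝ) :
    HasDerivAt (iteratedDeriv j φ) (iteratedDeriv (j + 1) φ x) x := by
  rw [iteratedDeriv_succ]
  exact (hφ.differentiable_iteratedDeriv j (by exact_mod_cast ENat.natCast_lt_top j) x).hasDerivAt

lemma ContDiff.continuous_iteratedDeriv_of_top {φ : ℝ → ℝ} (hφ : ContDiff ℝ (⊤ : ℕ∞) φ) (j : ℕ) :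
    Continuous (iteratedDeriv j φ) :=
  hφ.continuous_iteratedDeriv j (by exact_mod_cast le_top)

lemma Function.Periodic.iteratedDeriv {φ : ℝ → ℝ} {L : ℝ} (hφ : Function.Periodic φ L) (j : ℕ) :
    Function.Periodic (iteratedDeriv j φ) L := by
  intro x
  have h := congrFun (iteratedDeriv_comp_add_const j φ L) x
  rw [show (fun z => φ (z + L)) = φ from funext hφ] at h
  exact h.symm

/-- The `j`-th summand of the scale-invariant Sobolev norm. -/
noncomputable def scaledNorm (L : ℝ) (φ : ℝ → ℝ) (j : ℕ) : ℝ :=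
  L ^ ((j : ℝ) + 1 / 2) * √(∫ x in (0:ℝ)..L, iteratedDeriv j φ x ^ 2)

section ScaledNorm

variable {φ : ℝ → ℝ} {L : ℝ}

lemma scaledNorm_nonneg (hL : 0 < L) (j : ℕ) : 0 ≤ scaledNorm L φ j := by
  unfold scaledNorm
  positivity

lemma sobNorm_eq_sum_scaledNorm (K : ℕ) :
    sobNorm K L φ = ∑ j ∈ Finset.range (K + 1), scaledNorm L φ j := by
  simp only [sobNorm, scaledNorm, Real.sqrt_eq_rpow]

lemma scaledNorm_le_sobNorm (hL : 0 < L) {j K : ℕ} (hj : j ≤ K) :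
    scaledNorm L φ j ≤ sobNorm K L φ := by
  rw [sobNorm_eq_sum_scaledNorm]
  exact Finset.single_le_sum (fun i _ => scaledNorm_nonneg hL i)
    (Finset.mem_range.2 (Nat.lt_succ_of_le hj))

lemma sqrt_integral_sq_eq_scaledNorm (hL : 0 < L) (j : ℕ) :
    √(∫ x in (0:ℝ)..L, iteratedDeriv j φ x ^ 2) =
      L ^ (-((j : ℝ) + 1 / 2)) * scaledNorm L φ j := by
  rw [scaledNorm, ← mul_assoc, ← Real.rpow_add hL, neg_add_cancel, Real.rpow_zero, one_mul]

lemma scaledNorm_zero (hL : 0 < L) :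
    scaledNorm L φ 0 = √(L * ∫ x in (0:ℝ)..L, φ x ^ 2) := by
  rw [scaledNorm, Real.sqrt_mul hL.le, Real.sqrt_eq_rpow L]
  simp

lemma scaledNorm_succ_sq_le (hφ : ContDiff ℝ (⊤ : ℕ∞) φ) (hper : Function.Periodic φ L)
    (hL : 0 < L) (j : ℕ) :
    scaledNorm L φ (j + 1) ^ 2 ≤ scaledNorm L φ j * scaledNorm L φ (j + 2) := by
  have hbd : ∀ i, iteratedDeriv i φ 0 = iteratedDeriv i φ L := fun i => by
    simpa using ((hper.iteratedDeriv i) 0).symm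
  have h := integral_deriv_sq_le_sqrt_mul_sqrt hL.le (hφ.hasDerivAt_iteratedDeriv j)
    (hφ.hasDerivAt_iteratedDeriv (j + 1)) (hφ.continuous_iteratedDeriv_of_top _) (hbd _) (hbd _)
  have hpow : L ^ ((j : ℝ) + 1 / 2) * L ^ (((j + 2 : ℕ) : ℝ) + 1 / 2) =
      (L ^ (((j + 1 : ℕ) : ℝ) + 1 / 2)) ^ 2 := by
    rw [← Real.rpow_add hL, ← Real.rpow_mul_natCast hL.le]
    congr 1
    push_cast
    ring
  simp only [scaledNorm]
  rw [mul_pow, Real.sq_sqrt (integral_nonneg hL.le fun x _ => sq_nonneg _), mul_mul_mul_comm, hpow]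
  exact mul_le_mul_of_nonneg_left h (by positivity)

/-- Interpolation of intermediate derivatives in `L²`. -/
lemma scaledNorm_le_rpow_mul_rpow (hφ : ContDiff ℝ (⊤ : ℕ∞) φ) (hper : Function.Periodic φ L)
    (hL : 0 < L) {j K : ℕ} (hK : 1 ≤ K) (hj : j ≤ K) :
    scaledNorm L φ j ≤
      scaledNorm L φ 0 ^ (1 - (j : ℝ) / K) * sobNorm K L φ ^ ((j : ℝ) / K) := by
  refine (le_rpow_mul_rpow_of_logConvex (scaledNorm_nonneg hL)
    (scaledNorm_succ_sq_le hφ hper hL) hK hj).trans ?_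
  exact mul_le_mul_of_nonneg_left (Real.rpow_le_rpow (scaledNorm_nonneg hL _)
    (scaledNorm_le_sobNorm hL le_rfl) (by positivity))
    (Real.rpow_nonneg (scaledNorm_nonneg hL _) _)

/-- Interpolation of intermediate derivatives in the sup norm. -/
lemma abs_iteratedDeriv_le_rpow_mul_rpow (hφ : ContDiff ℝ (⊤ : ℕ∞) φ)
    (hper : Function.Periodic φ L) (hL : 0 < L) {j K : ℕ} (hj : j + 1 ≤ K) {x : ℝ}
    (hx : x ∈ Set.Icc 0 L) :
    |iteratedDeriv j φ x| ≤ L ^ (-((j : ℝ) + 1)) *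
      (2 * (scaledNorm L φ 0 ^ (1 - ((j : ℝ) + 1 / 2) / K) *
        sobNorm K L φ ^ (((j : ℝ) + 1 / 2) / K))) := by
  have hK : (0 : ℝ) < K := by
    have : 0 < K := by omega
    exact_mod_cast this
  have hjK : (j : ℝ) + 1 ≤ K := by exact_mod_cast hj
  set a := scaledNorm L φ 0
  set S := sobNorm K L φ
  have ha : 0 ≤ a := scaledNorm_nonneg hL 0
  have haS : a ≤ S := scaledNorm_le_sobNorm hL (Nat.zero_le K)
  have hS : 0 ≤ S := ha.trans haS
  have hA0 := scaledNorm_nonneg (φ := φ) hL j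
  have hexp : (0 : ℝ) ≤ 1 - ((j : ℝ) + 1) / K := sub_nonneg.2 ((div_le_one hK).2 hjK)
  have hexp' : (0 : ℝ) ≤ 1 - ((j : ℝ) + 1 / 2) / K :=
    sub_nonneg.2 ((div_le_one hK).2 (by linarith))
  have hj1 : scaledNorm L φ j ≤ a ^ (1 - (j : ℝ) / K) * S ^ ((j : ℝ) / K) :=
    scaledNorm_le_rpow_mul_rpow hφ hper hL (by omega) (by omega)
  have hj2 : scaledNorm L φ (j + 1) ≤ a ^ (1 - ((j : ℝ) + 1) / K) * S ^ (((j : ℝ) + 1) / K) := by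
    exact_mod_cast scaledNorm_le_rpow_mul_rpow hφ hper hL (by omega) hj
  have hj3 : scaledNorm L φ j ≤ a ^ (1 - ((j : ℝ) + 1) / K) * S ^ (((j : ℝ) + 1) / K) := by
    refine hj1.trans ?_
    rw [show 1 - (j : ℝ) / K = (1 - ((j : ℝ) + 1) / K) + 1 / K by ring,
      Real.rpow_add_of_nonneg ha hexp (by positivity),
      show ((j : ℝ) + 1) / K = 1 / K + j / K by ring,
      Real.rpow_add_of_nonneg hS (by positivity) (by positivity), mul_assoc]
    gcongr
  set B := a ^ (1 - ((j : ℝ) + 1 / 2) / K) * S ^ (((j : ℝ) + 1 / 2) / K) with hB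
  have hBsq : (a ^ (1 - (j : ℝ) / K) * S ^ ((j : ℝ) / K)) *
      (a ^ (1 - ((j : ℝ) + 1) / K) * S ^ (((j : ℝ) + 1) / K)) = B ^ 2 := by
    rw [hB, mul_pow, ← Real.rpow_mul_natCast ha, ← Real.rpow_mul_natCast hS, mul_mul_mul_comm,
      ← Real.rpow_add_of_nonneg ha _ hexp,
      ← Real.rpow_add_of_nonneg hS (by positivity) (by positivity)]
    · congr 2 <;> (push_cast; ring)
    · exact sub_nonneg.2 ((div_le_one hK).2 (by linarith))
  have hsq1 : scaledNorm L φ j * scaledNorm L φ j ≤ B ^ 2 :=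
    hBsq ▸ mul_le_mul hj1 hj3 hA0 (hA0.trans hj1)
  have hsq2 : scaledNorm L φ j * scaledNorm L φ (j + 1) ≤ B ^ 2 :=
    hBsq ▸ mul_le_mul hj1 hj2 (scaledNorm_nonneg hL _) (hA0.trans hj1)
  have hsup := mul_sq_le_integral_sq_add hL (hφ.hasDerivAt_iteratedDeriv j)
    (hφ.continuous_iteratedDeriv_of_top (j + 1)) hx
  rw [← Real.mul_self_sqrt (integral_nonneg (μ := volume) (f := fun y => iteratedDeriv j φ y ^ 2)
    hL.le fun x _ => sq_nonneg _)] at hsup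
  simp only [sqrt_integral_sq_eq_scaledNorm hL, Real.sqrt_mul_self
    (mul_nonneg (Real.rpow_nonneg hL.le _) hA0)] at hsup
  set r := L ^ (-((j : ℝ) + 1)) with hr
  have hr0 : 0 < r := Real.rpow_pos_of_pos hL _
  have hB0 : 0 ≤ B := by positivity
  have hp1 : L ^ (-((j : ℝ) + 1 / 2)) * L ^ (-((j : ℝ) + 1 / 2)) = L * r ^ 2 := by
    rw [hr, ← Real.rpow_mul_natCast hL.le, ← Real.rpow_add hL, ← Real.rpow_one_add' hL.le]
    · congr 1
      push_cast
      ring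
    · push_cast
      linarith [(Nat.cast_nonneg j : (0 : ℝ) ≤ j)]
  have hp2 : L * (L ^ (-((j : ℝ) + 1 / 2)) * L ^ (-(((j + 1 : ℕ) : ℝ) + 1 / 2))) = L * r ^ 2 := by
    rw [hr, ← Real.rpow_mul_natCast hL.le, ← Real.rpow_add hL]
    congr 2
    push_cast
    ring
  have hmain : L * iteratedDeriv j φ x ^ 2 ≤ L * (r * (2 * B)) ^ 2 := by
    calc L * iteratedDeriv j φ x ^ 2
        ≤ L * r ^ 2 * (scaledNorm L φ j * scaledNorm L φ j) +
          2 * (L * r ^ 2 * (scaledNorm L φ j * scaledNorm L φ (j + 1))) := by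
            refine hsup.trans_eq ?_
            rw [← hp2]
            nth_rewrite 1 [hp2]
            rw [← hp1]
            ring
      _ ≤ L * r ^ 2 * B ^ 2 + 2 * (L * r ^ 2 * B ^ 2) := by gcongr
      _ ≤ L * (r * (2 * B)) ^ 2 := by
        have : 0 ≤ L * r ^ 2 * B ^ 2 := by positivity
        linarith
  exact abs_le_of_sq_le_sq (le_of_mul_le_mul_left hmain hL) (by positivity)

/-- Cauchy–Schwarz on two factors and the sup bound on the remaining ones. -/
lemma integral_abs_prod_iteratedDeriv_le (hφ : ContDiff ℝ (⊤ : ℕ∞) φ)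
    (hper : Function.Periodic φ L) (hL : 0 < L) {K n : ℕ} (p q : ℕ) (κ : Fin n → ℕ)
    (hp : p + 1 ≤ K) (hq : q + 1 ≤ K) (hκ : ∀ j, κ j + 1 ≤ K) :
    ∫ x in (0:ℝ)..L, |iteratedDeriv p φ x * (iteratedDeriv q φ x *
      ∏ j, iteratedDeriv (κ j) φ x)| ≤
    (L ^ (-((p : ℝ) + 1 / 2)) *
      (scaledNorm L φ 0 ^ (1 - (p : ℝ) / K) * sobNorm K L φ ^ ((p : ℝ) / K))) *
    (L ^ (-((q : ℝ) + 1 / 2)) *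
      (scaledNorm L φ 0 ^ (1 - (q : ℝ) / K) * sobNorm K L φ ^ ((q : ℝ) / K))) *
    ∏ j, (L ^ (-((κ j : ℝ) + 1)) *
      (2 * (scaledNorm L φ 0 ^ (1 - ((κ j : ℝ) + 1 / 2) / K) *
        sobNorm K L φ ^ (((κ j : ℝ) + 1 / 2) / K)))) := by
  have hcont := hφ.continuous_iteratedDeriv_of_top
  have ha : 0 ≤ scaledNorm L φ 0 := scaledNorm_nonneg hL 0
  have hS : 0 ≤ sobNorm K L φ := ha.trans (scaledNorm_le_sobNorm hL (Nat.zero_le K))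
  set M := ∏ j, (L ^ (-((κ j : ℝ) + 1)) *
      (2 * (scaledNorm L φ 0 ^ (1 - ((κ j : ℝ) + 1 / 2) / K) *
        sobNorm K L φ ^ (((κ j : ℝ) + 1 / 2) / K)))) with hM
  have hM0 : 0 ≤ M := by positivity
  calc ∫ x in (0:ℝ)..L, |iteratedDeriv p φ x * (iteratedDeriv q φ x *
        ∏ j, iteratedDeriv (κ j) φ x)|
      ≤ ∫ x in (0:ℝ)..L, |iteratedDeriv p φ x * iteratedDeriv q φ x| * M := by
        refine integral_mono_on hL.le (Continuous.intervalIntegrable (by fun_prop) _ _)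
          (Continuous.intervalIntegrable (by fun_prop) _ _) fun x hx => ?_
        rw [← mul_assoc, abs_mul, Finset.abs_prod]
        exact mul_le_mul_of_nonneg_left (Finset.prod_le_prod (fun _ _ => abs_nonneg _)
          fun j _ => abs_iteratedDeriv_le_rpow_mul_rpow hφ hper hL (hκ j) hx) (abs_nonneg _)
    _ = (∫ x in (0:ℝ)..L, |iteratedDeriv p φ x * iteratedDeriv q φ x|) * M :=
        integral_mul_const _ _
    _ ≤ (√(∫ x in (0:ℝ)..L, iteratedDeriv p φ x ^ 2) *
          √(∫ x in (0:ℝ)..L, iteratedDeriv q φ x ^ 2)) * M := by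
        gcongr
        exact integral_abs_mul_le_sqrt_mul_sqrt (hcont p) (hcont q) hL.le
    _ ≤ _ := by
        rw [sqrt_integral_sq_eq_scaledNorm hL, sqrt_integral_sq_eq_scaledNorm hL]
        have := scaledNorm_nonneg (φ := φ) hL q
        gcongr
        · exact scaledNorm_le_rpow_mul_rpow hφ hper hL (by omega) (by omega)
        · exact scaledNorm_le_rpow_mul_rpow hφ hper hL (by omega) (by omega)

end ScaledNorm

/-- Collecting the exponents of a product of powers of a common base. -/
lemma rpow_mul_rpow_mul_prod_rpow {b : ℝ} (hb : 0 ≤ b) {n : ℕ} {s t : ℝ} {u : Fin n → ℝ}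
    (hs : 0 ≤ s) (ht : 0 ≤ t) (hu : ∀ j, 0 ≤ u j) :
    b ^ s * b ^ t * ∏ j, b ^ u j = b ^ (s + t + ∑ j, u j) := by
  rw [Real.rpow_add_of_nonneg hb (add_nonneg hs ht) (Finset.sum_nonneg fun j _ => hu j),
    Real.rpow_add_of_nonneg hb hs ht, Real.rpow_sum_of_nonneg hb fun j _ => hu j]

/-- **Product-of-derivatives estimate of Dziuk–Kuwert–Schätzle** (Appendix
Lemma A.4). For `K ≥ 1`, `ν ≥ 2` there is `c = c(K,μ,ν) > 0` such that for
every smooth `L`-periodic `φ` and nonnegative integers `i₁,…,i_ν` with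
`i₁+⋯+i_ν = μ` and `i_j ≤ K−1`, with `η = (μ + ν/2 − 1)/K`:
`∫₀^L |φ^{(i₁)}⋯φ^{(i_ν)}| ≤ c L^{1−μ−ν} (L ∫₀^L φ²)^{(ν−η)/2} ‖φ‖_{K,2}^η`. -/
theorem dks_product_estimate :
    ∀ K μ ν : ℕ, 1 ≤ K → 2 ≤ ν → ∃ c : ℝ, 0 < c ∧
      ∀ (φ : ℝ → ℝ) (L : ℝ) (ι : Fin ν → ℕ),
        ContDiff ℝ (⊤ : ℕ∞) φ → Function.Periodic φ L → 0 < L →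
        (∑ j, ι j) = μ → (∀ j, ι j ≤ K - 1) →
        (∫ x in (0:ℝ)..L, |∏ j, iteratedDeriv (ι j) φ x|) ≤
          c * L ^ ((1 : ℝ) - μ - ν) *
            (L * ∫ x in (0:ℝ)..L, (φ x) ^ 2) ^
              (((ν : ℝ) - ((μ : ℝ) + (ν : ℝ) / 2 - 1) / K) / 2) *
            sobNorm K L φ ^ (((μ : ℝ) + (ν : ℝ) / 2 - 1) / K) := by
  intro K μ ν hK hν
  obtain ⟨n, rfl⟩ := Nat.exists_eq_add_of_le' hν
  refine ⟨2 ^ n, by positivity, fun φ L ι hφ hper hL hsum hι => ?_⟩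
  have hι' : ∀ j, ι j + 1 ≤ K := fun j => by have := hι j; omega
  have hKpos : (0 : ℝ) < K := by exact_mod_cast hK
  have hιK : ∀ j, (ι j : ℝ) + 1 ≤ K := fun j => by exact_mod_cast hι' j
  have ha : 0 ≤ scaledNorm L φ 0 := scaledNorm_nonneg hL 0
  have hS : 0 ≤ sobNorm K L φ := ha.trans (scaledNorm_le_sobNorm hL (Nat.zero_le K))
  have hbound := integral_abs_prod_iteratedDeriv_le hφ hper hL (ι 0) (ι (Fin.succ 0))
    (fun j : Fin n => ι j.succ.succ) (hι' _) (hι' _) fun j => hι' _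
  have hsumR : (ι 0 : ℝ) + ι (Fin.succ 0) + ∑ j : Fin n, (ι j.succ.succ : ℝ) = μ := by
    rw [← hsum, Fin.sum_univ_succ, Fin.sum_univ_succ]
    push_cast
    ring
  have hLpow := Real.rpow_sum_of_pos hL (fun j : Fin n => -((ι j.succ.succ : ℝ) + 1)) Finset.univ
  have hapow := rpow_mul_rpow_mul_prod_rpow (n := n) ha (s := 1 - (ι 0 : ℝ) / K)
    (t := 1 - (ι (Fin.succ 0) : ℝ) / K) (u := fun j => 1 - ((ι j.succ.succ : ℝ) + 1 / 2) / K)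
    (sub_nonneg.2 ((div_le_one hKpos).2 (by linarith [hιK 0])))
    (sub_nonneg.2 ((div_le_one hKpos).2 (by linarith [hιK (Fin.succ 0)])))
    (fun j => sub_nonneg.2 ((div_le_one hKpos).2 (by linarith [hιK j.succ.succ])))
  have hSpow := rpow_mul_rpow_mul_prod_rpow (n := n) hS (s := (ι 0 : ℝ) / K)
    (t := (ι (Fin.succ 0) : ℝ) / K) (u := fun j => ((ι j.succ.succ : ℝ) + 1 / 2) / K)
    (by positivity) (by positivity) (fun j => by positivity)
  have hη : (ι 0 : ℝ) / K + (ι (Fin.succ 0) : ℝ) / K +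
      ∑ j : Fin n, ((ι j.succ.succ : ℝ) + 1 / 2) / K =
      ((μ : ℝ) + ((n + 2 : ℕ) : ℝ) / 2 - 1) / K := by
    rw [← Finset.sum_div, Finset.sum_add_distrib, ← hsumR]
    simp only [Finset.sum_const, Finset.card_univ, Fintype.card_fin, nsmul_eq_mul]
    push_cast
    ring
  have hνη : (1 - (ι 0 : ℝ) / K) + (1 - (ι (Fin.succ 0) : ℝ) / K) +
      ∑ j : Fin n, (1 - ((ι j.succ.succ : ℝ) + 1 / 2) / K) =
      ((n + 2 : ℕ) : ℝ) - ((μ : ℝ) + ((n + 2 : ℕ) : ℝ) / 2 - 1) / K := by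
    rw [← hη, Finset.sum_sub_distrib]
    simp only [Finset.sum_const, Finset.card_univ, Fintype.card_fin, nsmul_eq_mul]
    push_cast
    ring
  have hLexp : L ^ (-((ι 0 : ℝ) + 1 / 2)) * L ^ (-((ι (Fin.succ 0) : ℝ) + 1 / 2)) *
      ∏ j : Fin n, L ^ (-((ι j.succ.succ : ℝ) + 1)) = L ^ ((1 : ℝ) - μ - ((n + 2 : ℕ) : ℝ)) := by
    rw [← hLpow, ← Real.rpow_add hL, ← Real.rpow_add hL, ← hsumR, Finset.sum_neg_distrib,
      Finset.sum_add_distrib]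
    simp only [Finset.sum_const, Finset.card_univ, Fintype.card_fin, nsmul_eq_mul]
    congr 1
    push_cast
    ring
  rw [hνη] at hapow
  rw [hη] at hSpow
  have hbase : (L * ∫ x in (0:ℝ)..L, (φ x) ^ 2) ^
      ((((n + 2 : ℕ) : ℝ) - ((μ : ℝ) + ((n + 2 : ℕ) : ℝ) / 2 - 1) / K) / 2) =
      scaledNorm L φ 0 ^ (((n + 2 : ℕ) : ℝ) - ((μ : ℝ) + ((n + 2 : ℕ) : ℝ) / 2 - 1) / K) := by
    rw [scaledNorm_zero hL, Real.sqrt_eq_rpow, ← Real.rpow_mul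
      (mul_nonneg hL.le (integral_nonneg hL.le fun x _ => sq_nonneg _))]
    congr 1
    ring
  rw [hbase, ← hLexp, ← hapow, ← hSpow]
  simp only [Fin.prod_univ_succ (n := n + 1), Fin.prod_univ_succ (n := n)]
  refine hbound.trans_eq ?_
  simp only [Finset.prod_mul_distrib, Finset.prod_const, Finset.card_univ, Fintype.card_fin]
  ring
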